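/- arXiv:1307.1856 — 3 statements merged into one kernel-verified Lean document; each statement's English description precedes it below -/
import Mathlib

section
/- The characteristic function of the hyperbolic secant distribution is the hyperbolic secant: for every α ∈ ℝ, ∫_ℝ e^{iαx} · (1/2) sech(πx/2) dx = 1/cosh α. In particular (1/2) sech(πx/2) is a probability density on ℝ. -/
open MeasureTheory Real

/-- The Beta integral, transported to the real line by the sigmoid substitution. -/
theorem betaIntegral_eq_integral_sigmoid (u v : ℂ) :
    Complex.betaIntegral u v =
      ∫ x : ℝ, (Real.sigmoid x : ℂ) ^ u * (Real.sigmoid (-x) : ℂ) ^ v := by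
  rw [Complex.betaIntegral, intervalIntegral.integral_of_le zero_le_one,
    integral_Ioc_eq_integral_Ioo, ← range_sigmoid, ← Set.image_univ,
    integral_image_eq_integral_abs_deriv_smul MeasurableSet.univ
      (fun x _ => (hasDerivAt_sigmoid x).hasDerivWithinAt) sigmoid_injective.injOn,
    setIntegral_univ]
  refine integral_congr_ae (.of_forall fun x => ?_)
  have h0 : (sigmoid x : ℂ) ≠ 0 := by exact_mod_cast (sigmoid_pos x).ne'
  have h1 : (sigmoid (-x) : ℂ) ≠ 0 := by exact_mod_cast (sigmoid_pos (-x)).ne'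
  have h2 : (1 - (sigmoid x : ℂ)) = (sigmoid (-x) : ℂ) := by
    rw [sigmoid_neg]; push_cast; rfl
  simp only [← sigmoid_neg]
  rw [abs_of_pos (mul_pos (sigmoid_pos x) (sigmoid_pos (-x))), h2, Complex.cpow_sub _ _ h0,
    Complex.cpow_sub _ _ h1, Complex.real_smul]
  simp only [Complex.cpow_one]
  push_cast
  field_simp

theorem sigmoid_cpow_mul_sigmoid_neg_cpow_one_sub (s : ℂ) (x : ℝ) :
    (Real.sigmoid x : ℂ) ^ s * (Real.sigmoid (-x) : ℂ) ^ (1 - s) =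
      Complex.exp (s * x) / (1 + Complex.exp x) := by
  have h0 : (sigmoid (-x) : ℂ) ≠ 0 := by exact_mod_cast (sigmoid_pos (-x)).ne'
  have h1 : (sigmoid x : ℂ) = (Real.exp x : ℂ) * (sigmoid (-x) : ℂ) := by
    have := sigmoid_mul_rexp_neg (-x)
    rw [neg_neg] at this
    rw [← this]; push_cast; ring
  rw [h1, Complex.mul_cpow_ofReal_nonneg (Real.exp_pos x).le (sigmoid_nonneg _), mul_assoc,
    ← Complex.cpow_add _ _ h0, add_sub_cancel, Complex.cpow_one,
    Complex.cpow_def_of_ne_zero (by exact_mod_cast (Real.exp_pos x).ne'),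
    ← Complex.ofReal_log (Real.exp_pos x).le, Real.log_exp, sigmoid_def, neg_neg]
  push_cast
  rw [mul_comm s, div_eq_mul_inv]

/-- For `0 < re s < 1`, `∫ e^{sx} / (1 + e^x) dx = π / sin (π s)`. -/
theorem integral_cexp_mul_div_one_add_cexp {s : ℂ} (hs : 0 < s.re) (hs' : s.re < 1) :
    ∫ x : ℝ, Complex.exp (s * x) / (1 + Complex.exp x) = π / Complex.sin (π * s) := by
  have h := Complex.Gamma_mul_Gamma_eq_betaIntegral hs
    (show 0 < (1 - s).re by simpa using hs')
  rw [add_sub_cancel, Complex.Gamma_one, one_mul, Complex.Gamma_mul_Gamma_one_sub,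
    betaIntegral_eq_integral_sigmoid] at h
  simp only [h, sigmoid_cpow_mul_sigmoid_neg_cpow_one_sub]

theorem integral_cexp_mul_half_sech (α : ℝ) :
    ∫ x : ℝ, Complex.exp (Complex.I * (α : ℂ) * (x : ℂ))
        * ((1 / 2) * (1 / Real.cosh (Real.pi * x / 2)) : ℝ)
      = ((1 / Real.cosh α : ℝ) : ℂ) := by
  have hπ : (π : ℂ) ≠ 0 := by exact_mod_cast pi_ne_zero
  set s : ℂ := 1 / 2 + Complex.I * α / π with hs
  have hre : s.re = 1 / 2 := by
    simp [hs, Complex.div_ofReal_re]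
  have hint := Measure.integral_comp_mul_left
    (fun x : ℝ => Complex.exp (s * x) / (1 + Complex.exp x)) π
  rw [integral_cexp_mul_div_one_add_cexp (by rw [hre]; norm_num) (by rw [hre]; norm_num),
    abs_of_pos (inv_pos.2 pi_pos), Complex.real_smul] at hint
  have hsin : Complex.sin (π * s) = Complex.cosh α := by
    rw [show π * s = α * Complex.I + π / 2 by rw [hs]; field_simp; ring,
      Complex.sin_add_pi_div_two, Complex.cos_mul_I]
  rw [hsin] at hint
  convert! hint using 1
  · refine integral_congr_ae (.of_forall fun x => ?_)
    have hne : (1 + Complex.exp ((π * x : ℝ) : ℂ)) ≠ 0 := by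
      exact_mod_cast (add_pos one_pos (Real.exp_pos (π * x))).ne'
    have hcosh : Complex.cosh (π * x / 2) ≠ 0 := by
      exact_mod_cast (Real.cosh_pos (π * x / 2)).ne'
    have hsx : s * ((π * x : ℝ) : ℂ) = Complex.I * α * x + π * x / 2 := by
      rw [hs]; push_cast; field_simp; ring
    have hfac : 1 + Complex.exp ((π * x : ℝ) : ℂ) =
        2 * Complex.exp (π * x / 2) * Complex.cosh (π * x / 2) := by
      rw [mul_right_comm, Complex.two_cosh, add_mul, ← Complex.exp_add, ← Complex.exp_add]
      push_cast
      rw [add_halves, neg_add_cancel, Complex.exp_zero, add_comm]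
    have hexp := Complex.exp_ne_zero (π * x / 2)
    simp only [hsx, hfac, Complex.exp_add]
    push_cast
    field_simp
  · push_cast
    field_simp

/-- **Characteristic function of the hyperbolic secant distribution.**
For every `α ∈ ℝ`, `∫_ℝ e^{iαx} · (1/2) sech(πx/2) dx = 1/cosh α`; in particular
`(1/2) sech(πx/2)` is a probability density on `ℝ`. -/
theorem charFun_hyperbolic_secant (α : ℝ) :
    (∫ x : ℝ, Complex.exp (Complex.I * (α : ℂ) * (x : ℂ))
        * ((1 / 2) * (1 / Real.cosh (Real.pi * x / 2)) : ℝ))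
      = ((1 / Real.cosh α : ℝ) : ℂ) ∧
    (∫ x : ℝ, (1 / 2) * (1 / Real.cosh (Real.pi * x / 2))) = 1 := by
  refine ⟨integral_cexp_mul_half_sech α, ?_⟩
  have h := integral_cexp_mul_half_sech 0
  simp only [Complex.ofReal_zero, mul_zero, zero_mul, Complex.exp_zero, one_mul,
    integral_complex_ofReal, Real.cosh_zero, div_one] at h
  exact_mod_cast h
end

section
/- Relaxation of the correlation kernel to the discrete extended sine kernel. Let a ∈ {2, 3, …} and set ρ = 1/(2a) and M^{2aj}_a(τ, y) := (1/2π) ∫_{−π}^{π} e^{iλ(y/(2a) − j)} [cos(λ/(2a))]^{−τ} dλ. Fix s, t ∈ ℕ and x, y ∈ ℤ with s + x and t + y even. Then lim_{n→∞} Σ_{j∈ℤ} p(s + 2n, x | 2aj) · M^{2aj}_a(t + 2n, y) = 2 ∫_0^ρ cos(πu(y − x)) [cos(πu)]^{s−t} du, where for each n the series over j ∈ ℤ converges absolutely. Consequently the kernel K_n(s, x; t, y) := Σ_{j∈ℤ} p(s+2n, x|2aj) M^{2aj}_a(t+2n, y) − 1(s > t) p(s−t, x|y) converges as n → ∞ to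 the equilibrium kernel K_ρ(t−s, y−x) = 2∫_0^ρ cos(πu(y−x)) [cos(πu)]^{s−t} du − 1(s>t) p(s−t, x|y); in particular for s = t, y ≠ x the limit equals 2 sin(πρ(y−x))/(π(y−x)). -/
open Filter Topology MeasureTheory

/-- The transition probability of the simple symmetric random walk on `ℤ`. -/
noncomputable def rwTP (t : ℕ) (y x : ℤ) : ℝ :=
  if |y - x| ≤ (t : ℤ) ∧ Even ((t : ℤ) + y - x)
    then (Nat.choose t (((t : ℤ) + (y - x)) / 2).toNat : ℝ) / 2 ^ t else 0

theorem cos_pow_eq_sum_choose_mul_exp (T : ℕ) (θ : ℝ) :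
    ((Real.cos θ : ℝ) : ℂ) ^ T = ∑ m ∈ Finset.range (T + 1),
      ((T.choose m : ℂ) / 2 ^ T) * Complex.exp (Complex.I * θ * (2 * m - T)) := by
  rw [Complex.ofReal_cos, Complex.cos, div_pow, add_pow, Finset.sum_div]
  refine Finset.sum_congr rfl fun m hm => ?_
  have hmT : m ≤ T := Nat.lt_succ_iff.mp (Finset.mem_range.mp hm)
  rw [← Complex.exp_nat_mul, ← Complex.exp_nat_mul, ← Complex.exp_add, Nat.cast_sub hmT]
  rw [show (m : ℂ) * (θ * Complex.I) + (T - m) * (-θ * Complex.I)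
    = Complex.I * θ * (2 * m - T) by ring]
  ring

theorem sum_range_exp_eq_ite_dvd (a : ℕ) (ha : a ≠ 0) (d : ℤ) :
    ∑ k ∈ Finset.range a, Complex.exp (2 * Real.pi * Complex.I * k * d / a)
      = if (a : ℤ) ∣ d then (a : ℂ) else 0 := by
  have ha' : (a : ℂ) ≠ 0 := Nat.cast_ne_zero.mpr ha
  have hpow : ∀ k : ℕ, Complex.exp (2 * Real.pi * Complex.I * k * d / a)
      = Complex.exp (2 * Real.pi * Complex.I * d / a) ^ k := fun k => by
    rw [← Complex.exp_nat_mul]; congr 1; ring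
  simp only [hpow]
  have hone : Complex.exp (2 * Real.pi * Complex.I * d / a) = 1 ↔ (a : ℤ) ∣ d := by
    rw [Complex.exp_eq_one_iff]
    have h2 : (2 * Real.pi * Complex.I : ℂ) ≠ 0 := Complex.two_pi_I_ne_zero
    constructor
    · rintro ⟨n, hn⟩
      refine ⟨n, ?_⟩
      rw [div_eq_iff ha', mul_comm (n : ℂ), mul_assoc _ (n : ℂ)] at hn
      have := mul_left_cancel₀ h2 hn
      exact_mod_cast this.trans (mul_comm _ _)
    · rintro ⟨n, rfl⟩
      refine ⟨n, ?_⟩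
      push_cast
      field_simp
  split_ifs with h
  · rw [hone.mpr h]; simp
  · rw [geom_sum_eq (fun h' => h (hone.mp h')), ← Complex.exp_nat_mul,
      show (a : ℂ) * (2 * Real.pi * Complex.I * d / a) = d * (2 * Real.pi * Complex.I) by
        field_simp,
      Complex.exp_int_mul_two_pi_mul_I]
    simp

theorem rwTP_eq_choose (T : ℕ) (x z h : ℤ) (hh : (T : ℤ) + (x - z) = 2 * h) :
    rwTP T x z = if 0 ≤ h then (T.choose h.toNat : ℝ) / 2 ^ T else 0 := by
  have hdiv : ((T : ℤ) + (x - z)) / 2 = h := by omega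
  unfold rwTP
  rw [hdiv]
  by_cases h0 : 0 ≤ h
  · by_cases hT : h ≤ T
    · rw [if_pos ⟨abs_le.mpr ⟨by omega, by omega⟩, h, by omega⟩, if_pos h0]
    · rw [if_neg fun hc => hT (by have := (abs_le.mp hc.1).2; omega), if_pos h0,
        Nat.choose_eq_zero_of_lt (by omega)]
      simp
  · rw [if_neg h0, if_neg fun hc => h0 (by have := (abs_le.mp hc.1).1; omega)]

theorem hasSum_rwTP_mul_exp (a : ℕ) (ha : a ≠ 0) (T : ℕ) (x : ℤ) (hx : Even ((T : ℤ) + x))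
    (φ : ℝ) :
    HasSum (fun j : ℤ => ((rwTP T x (2 * (a : ℤ) * j) : ℝ) : ℂ)
        * Complex.exp (Complex.I * φ * (x - 2 * a * j)))
      ((1 / (a : ℂ)) * ∑ k ∈ Finset.range a, Complex.exp (-(Complex.I * Real.pi * k * x / a))
        * ((Real.cos (φ + Real.pi * k / a) : ℝ) : ℂ) ^ T) := by
  have ha' : (a : ℂ) ≠ 0 := Nat.cast_ne_zero.mpr ha
  obtain ⟨h, hh⟩ := hx
  let G : ℕ → ℂ := fun m => ((T.choose m : ℂ) / 2 ^ T)
    * Complex.exp (Complex.I * φ * (2 * m - T))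
  let F : ℤ → ℂ := fun m =>
    if 0 ≤ m ∧ (a : ℤ) ∣ m - h then G m.toNat else 0
  have hxc : (x : ℂ) = 2 * h - T := by
    have : x = 2 * h - T := by omega
    rw [this]; push_cast; ring
  have hFG : HasSum (F ∘ ((↑) : ℕ → ℤ)) (∑ m ∈ Finset.range (T + 1), F m) := by
    refine hasSum_sum_of_ne_finset_zero fun m hm => ?_
    have : T < m := by simpa using hm
    simp [F, G, Nat.choose_eq_zero_of_lt this]
  have hF : HasSum F (∑ m ∈ Finset.range (T + 1), F m) := by
    refine (Function.Injective.hasSum_iff Nat.cast_injective fun m hm => ?_).mp hFG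
    refine if_neg fun hc => hm ⟨m.toNat, by simp [hc.1]⟩
  have hinj : Function.Injective (fun j : ℤ => h - a * j) := fun i j hij => by
    have : (a : ℤ) * i = a * j := by simpa using hij
    exact mul_left_cancel₀ (by exact_mod_cast ha) this
  have hFj := (hinj.hasSum_iff (f := F) fun m hm => if_neg fun hc => hm (by
    obtain ⟨c, hc⟩ := hc.2
    exact ⟨-c, by simp only; linarith⟩)).mpr hF
  convert hFj using 1
  · funext j
    have hz : (T : ℤ) + (x - 2 * a * j) = 2 * (h - a * j) := by linarith
    rw [rwTP_eq_choose T x _ _ hz]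
    simp only [Function.comp, F]
    by_cases h0 : 0 ≤ h - a * j
    · rw [if_pos h0, if_pos ⟨h0, -j, by ring⟩]
      have hc : (((h - a * j).toNat : ℕ) : ℂ) = h - a * j := by
        have : (((h - a * j).toNat : ℤ) : ℂ) = ((h - a * j : ℤ) : ℂ) := by
          rw [Int.toNat_of_nonneg h0]
        push_cast at this
        exact this
      simp only [G, hc, hxc]
      push_cast
      congr 2
      ring
    · rw [if_neg h0, if_neg fun hc => h0 hc.1]
      simp
  · have hFm : ∀ m : ℕ, F m = (1 / (a : ℂ)) * ∑ k ∈ Finset.range a,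
        Complex.exp (2 * Real.pi * Complex.I * k * ((m : ℤ) - h : ℤ) / a) * G m := fun m => by
      rw [← Finset.sum_mul, sum_range_exp_eq_ite_dvd a ha]
      by_cases hd : (a : ℤ) ∣ m - h
      · simp [F, hd, ha']
      · simp [F, hd]
    simp only [hFm]
    rw [← Finset.mul_sum, Finset.sum_comm]
    congr 1
    refine Finset.sum_congr rfl fun k _ => ?_
    rw [cos_pow_eq_sum_choose_mul_exp, Finset.mul_sum]
    refine Finset.sum_congr rfl fun m _ => ?_
    simp only [G]
    rw [mul_left_comm, mul_left_comm (Complex.exp _), ← Complex.exp_add, ← Complex.exp_add]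
    congr 2
    rw [hxc]
    push_cast
    field_simp
    ring

theorem rwTP_eq_zero_of_notMem_Icc (a : ℕ) (ha : a ≠ 0) (T : ℕ) (x j : ℤ)
    (hj : j ∉ Finset.Icc (-(T + |x|)) (T + |x|)) : rwTP T x (2 * (a : ℤ) * j) = 0 := by
  refine if_neg fun hc => hj ?_
  rw [Finset.mem_Icc, ← abs_le]
  have h1 : |2 * (a : ℤ) * j| ≤ T + |x| := by
    have := abs_sub_abs_le_abs_sub (2 * (a : ℤ) * j) x
    rw [abs_sub_comm] at this
    linarith [hc.1]
  have h2 : (1 : ℤ) ≤ 2 * a := by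
    have : 1 ≤ a := Nat.one_le_iff_ne_zero.mpr ha
    omega
  rw [abs_mul, abs_of_nonneg (by omega : (0 : ℤ) ≤ 2 * a)] at h1
  nlinarith [abs_nonneg j]

theorem abs_cos_add_pi_mul_div_lt_cos (a k : ℕ) (hk : 0 < k) (hka : k < a) (φ : ℝ)
    (hφ : |φ| < Real.pi / (2 * a)) : |Real.cos (φ + Real.pi * k / a)| < Real.cos φ := by
  have ha : (0 : ℝ) < a := by exact_mod_cast hk.trans hka
  have hk1 : (1 : ℝ) ≤ k := by exact_mod_cast hk
  have hka1 : (k : ℝ) + 1 ≤ a := by exact_mod_cast hka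
  set δ := Real.pi / (2 * a) with hδ
  have hπ := Real.pi_pos
  have hδ0 : 0 < δ := by positivity
  have hδa : 2 * a * δ = Real.pi := by rw [hδ]; field_simp
  have hkδ : Real.pi * k / a = 2 * k * δ := by rw [hδ]; field_simp
  rw [hkδ]
  obtain ⟨h1, h2⟩ := abs_lt.mp hφ
  have hl : δ < φ + 2 * k * δ := by nlinarith
  have hu : φ + 2 * k * δ < Real.pi - δ := by nlinarith
  have hc : Real.cos δ < Real.cos φ := by
    rw [← Real.cos_abs φ]
    exact Real.cos_lt_cos_of_nonneg_of_le_pi (abs_nonneg _) (by nlinarith) hφ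
  have hup := Real.cos_lt_cos_of_nonneg_of_le_pi hδ0.le (by linarith) hl
  have hlow := Real.cos_lt_cos_of_nonneg_of_le_pi (hδ0.trans hl).le (by linarith) hu
  rw [Real.cos_pi_sub] at hlow
  exact abs_lt.mpr ⟨by linarith, by linarith⟩

theorem abs_div_two_mul_lt {a : ℕ} (ha : 0 < a) {l : ℝ} (hl : |l| < Real.pi) :
    |l / (2 * (a : ℝ))| < Real.pi / (2 * a) := by
  have : (0 : ℝ) < 2 * a := by positivity
  rw [abs_div, abs_of_pos this]
  gcongr

theorem cos_div_two_mul_pos {a : ℕ} (ha : 2 ≤ a) {l : ℝ} (hl : |l| ≤ Real.pi) :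
    0 < Real.cos (l / (2 * (a : ℝ))) := by
  have ha' : (2 : ℝ) ≤ a := by exact_mod_cast ha
  have : |l / (2 * (a : ℝ))| < Real.pi / 2 := by
    rw [abs_div, abs_of_pos (by linarith : (0 : ℝ) < 2 * a), div_lt_div_iff₀ (by linarith) two_pos]
    nlinarith [Real.pi_pos]
  exact Real.cos_pos_of_mem_Ioo (abs_lt.mp this)

/-- The integrand obtained by summing the series over `j` under the integral sign. -/
noncomputable def kernelIntegrand (a T τ : ℕ) (x y : ℤ) (l : ℝ) : ℂ :=
  Complex.exp (Complex.I * ((l / (2 * (a : ℝ)) : ℝ) : ℂ) * ((y : ℂ) - x))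
    * ((1 / (a : ℂ)) * ∑ k ∈ Finset.range a, Complex.exp (-(Complex.I * Real.pi * k * x / a))
      * (((Real.cos (l / (2 * (a : ℝ)) + Real.pi * k / a) : ℝ) : ℂ) ^ T
        / ((Real.cos (l / (2 * (a : ℝ))) : ℝ) : ℂ) ^ τ))

theorem continuousOn_cos_div_pow_inv {a : ℕ} (ha : 2 ≤ a) (τ : ℕ) {f : ℝ → ℂ}
    (hf : Continuous f) :
    ContinuousOn (fun l : ℝ => f l / ((Real.cos (l / (2 * (a : ℝ))) : ℝ) : ℂ) ^ τ)
      (Set.uIcc (-Real.pi) Real.pi) := by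
  refine hf.continuousOn.div (by fun_prop) fun l hl => pow_ne_zero _ ?_
  rw [Set.uIcc_of_le (by linarith [Real.pi_pos])] at hl
  exact_mod_cast (cos_div_two_mul_pos ha (abs_le.mpr hl)).ne'

theorem continuousOn_kernelIntegrand {a : ℕ} (ha : 2 ≤ a) (T τ : ℕ) (x y : ℤ) :
    ContinuousOn (kernelIntegrand a T τ x y) (Set.uIcc (-Real.pi) Real.pi) := by
  unfold kernelIntegrand
  refine ContinuousOn.mul (by fun_prop) (ContinuousOn.mul (by fun_prop) ?_)
  refine continuousOn_finsetSum _ fun k _ => ContinuousOn.mul (by fun_prop) ?_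
  exact continuousOn_cos_div_pow_inv ha τ (by fun_prop)

theorem tsum_rwTP_mul_integral {a : ℕ} (ha : 2 ≤ a) (T τ : ℕ) (x y : ℤ)
    (hx : Even ((T : ℤ) + x)) :
    ∑' j : ℤ, ((rwTP T x (2 * (a : ℤ) * j) : ℝ) : ℂ)
      * ((1 / (2 * (Real.pi : ℂ))) * ∫ l in (-Real.pi)..Real.pi,
        Complex.exp (Complex.I * (l : ℂ) * (((y : ℝ) / (2 * (a : ℝ)) : ℝ) - (j : ℂ)))
          / ((Real.cos (l / (2 * (a : ℝ))) : ℝ) : ℂ) ^ τ)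
    = (1 / (2 * (Real.pi : ℂ))) * ∫ l in (-Real.pi)..Real.pi, kernelIntegrand a T τ x y l := by
  have ha0 : a ≠ 0 := by omega
  have hac : (a : ℂ) ≠ 0 := Nat.cast_ne_zero.mpr ha0
  have hzero := rwTP_eq_zero_of_notMem_Icc a ha0 T x
  set S := Finset.Icc (-(T + |x|)) (T + |x|)
  rw [tsum_eq_sum (s := S) fun j hj => by rw [hzero j hj]; simp]
  simp only [mul_left_comm _ (1 / (2 * (Real.pi : ℂ)))]
  rw [← Finset.mul_sum]
  simp only [← intervalIntegral.integral_const_mul ((rwTP _ _ _ : ℝ) : ℂ)]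
  rw [← intervalIntegral.integral_finsetSum fun j _ =>
    ((continuousOn_cos_div_pow_inv ha τ (by fun_prop)).intervalIntegrable).const_mul _]
  congr 1
  refine intervalIntegral.integral_congr fun l _ => ?_
  have hs := hasSum_rwTP_mul_exp a ha0 T x hx (l / (2 * (a : ℝ)))
  have hs' := hs.unique (hasSum_sum_of_ne_finset_zero (s := S)
    fun j hj => by rw [hzero j hj]; simp)
  simp only [kernelIntegrand, ← mul_div_assoc, ← Finset.sum_div]
  rw [hs', Finset.mul_sum]
  congr 1
  refine Finset.sum_congr rfl fun j _ => ?_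
  rw [mul_left_comm, ← Complex.exp_add]
  congr 2
  push_cast
  field_simp
  ring

theorem tendsto_kernelIntegrand {a : ℕ} (ha : 2 ≤ a) (s t : ℕ) (x y : ℤ) {l : ℝ}
    (hl : |l| < Real.pi) :
    Tendsto (fun n : ℕ => kernelIntegrand a (s + 2 * n) (t + 2 * n) x y l) atTop
      (𝓝 (Complex.exp (Complex.I * ((l / (2 * (a : ℝ)) : ℝ) : ℂ) * ((y : ℂ) - x))
        * ((1 / (a : ℂ))
          * ((Real.cos (l / (2 * (a : ℝ))) ^ ((s : ℤ) - (t : ℤ)) : ℝ) : ℂ)))) := by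
  have hc := cos_div_two_mul_pos ha hl.le
  have hφ := abs_div_two_mul_lt (by omega : 0 < a) hl
  unfold kernelIntegrand
  set φ := l / (2 * (a : ℝ)) with hφdef
  refine Tendsto.const_mul _ (Tendsto.const_mul _ ?_)
  have hcc : ((Real.cos φ : ℝ) : ℂ) ≠ 0 := by exact_mod_cast hc.ne'
  have hsum : ((Real.cos φ ^ ((s : ℤ) - (t : ℤ)) : ℝ) : ℂ) = ∑ k ∈ Finset.range a,
      if k = 0 then ((Real.cos φ ^ ((s : ℤ) - (t : ℤ)) : ℝ) : ℂ) else 0 := by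
    rw [Finset.sum_ite_eq' _ 0, if_pos (Finset.mem_range.mpr (by omega))]
  rw [hsum]
  refine tendsto_finsetSum _ fun k hk => ?_
  split_ifs with hk0
  · subst hk0
    refine tendsto_const_nhds.congr fun n => ?_
    simp only [Nat.cast_zero, mul_zero, zero_mul, zero_div, neg_zero, Complex.exp_zero, one_mul,
      add_zero]
    push_cast at hcc ⊢
    rw [zpow_sub₀ hcc, zpow_natCast, zpow_natCast, pow_add, pow_add,
      mul_div_mul_right _ _ (pow_ne_zero _ hcc)]
  · have hlt := abs_cos_add_pi_mul_div_lt_cos a k (Nat.pos_of_ne_zero hk0)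
      (Finset.mem_range.mp hk) φ hφ
    set θ := φ + Real.pi * k / a
    have hr : |(Real.cos θ / Real.cos φ) ^ 2| < 1 := by
      rw [abs_pow, abs_div, abs_of_pos hc]
      exact pow_lt_one₀ (by positivity) ((div_lt_one hc).mpr hlt) two_ne_zero
    have h0 := (((tendsto_pow_atTop_nhds_zero_of_abs_lt_one hr).mul_const
      (Real.cos θ ^ s / Real.cos φ ^ t)).ofReal).const_mul
        (Complex.exp (-(Complex.I * Real.pi * k * x / a)))
    simp only [zero_mul, Complex.ofReal_zero, mul_zero] at h0
    refine h0.congr fun n => ?_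
    congr 1
    norm_cast
    rw [← pow_mul, div_pow, pow_add, pow_add]
    ring

theorem abs_cos_add_pi_mul_div_le_cos (a k : ℕ) (hka : k < a) (φ : ℝ)
    (hφ : |φ| < Real.pi / (2 * a)) (hc : 0 < Real.cos φ) :
    |Real.cos (φ + Real.pi * k / a)| ≤ Real.cos φ := by
  rcases Nat.eq_zero_or_pos k with rfl | hk
  · simp [abs_of_pos hc]
  · exact (abs_cos_add_pi_mul_div_lt_cos a k hk hka φ hφ).le

theorem norm_kernelIntegrand_le {a : ℕ} (ha : 2 ≤ a) (s t n : ℕ) (x y : ℤ) {l : ℝ}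
    (hl : |l| < Real.pi) :
    ‖kernelIntegrand a (s + 2 * n) (t + 2 * n) x y l‖
      ≤ 1 / Real.cos (l / (2 * (a : ℝ))) ^ t := by
  have hc := cos_div_two_mul_pos ha hl.le
  have hφ := abs_div_two_mul_lt (by omega : 0 < a) hl
  have ha0 : (0 : ℝ) < a := by exact_mod_cast (by omega : 0 < a)
  unfold kernelIntegrand
  set φ := l / (2 * (a : ℝ))
  have he : ‖Complex.exp (Complex.I * (φ : ℂ) * ((y : ℂ) - x))‖ = 1 := by
    have := Complex.norm_exp_ofReal_mul_I (φ * (y - x))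
    rw [← this]; push_cast; ring_nf
  have hek : ∀ k : ℕ, ‖Complex.exp (-(Complex.I * Real.pi * k * x / a))‖ = 1 := fun k => by
    have := Complex.norm_exp_ofReal_mul_I (-(Real.pi * k * x / a))
    rw [← this]; push_cast; ring_nf
  rw [norm_mul, he, one_mul, norm_mul, norm_div, norm_one, Complex.norm_natCast]
  have hs : ‖∑ k ∈ Finset.range a, Complex.exp (-(Complex.I * Real.pi * k * x / a))
      * (((Real.cos (φ + Real.pi * k / a) : ℝ) : ℂ) ^ (s + 2 * n)
        / ((Real.cos φ : ℝ) : ℂ) ^ (t + 2 * n))‖ ≤ a * (1 / Real.cos φ ^ t) := by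
    refine (norm_sum_le_of_le (n := fun _ => 1 / Real.cos φ ^ t) _
      fun k hk => ?_).trans (by simp)
    rw [norm_mul, hek, one_mul, norm_div, norm_pow, norm_pow, Complex.norm_real,
      Complex.norm_real, Real.norm_eq_abs, Real.norm_eq_abs, abs_of_pos hc]
    have hle := abs_cos_add_pi_mul_div_le_cos a k (Finset.mem_range.mp hk) φ hφ hc
    rw [pow_add, pow_add, div_le_div_iff₀ (by positivity) (by positivity)]
    have h1 : |Real.cos (φ + Real.pi * k / a)| ^ s ≤ 1 :=
      pow_le_one₀ (abs_nonneg _) (Real.abs_cos_le_one _)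
    have h2 := pow_le_pow_left₀ (abs_nonneg _) hle (2 * n)
    calc _ ≤ 1 * Real.cos φ ^ (2 * n) * Real.cos φ ^ t := by gcongr
      _ = _ := by ring
  calc _ ≤ 1 / (a : ℝ) * (a * (1 / Real.cos φ ^ t)) := by gcongr
    _ = _ := by field_simp

theorem integral_exp_mul_eq_two_mul_integral_cos (g : ℝ → ℝ) (hg : ∀ v, g (-v) = g v)
    (r c : ℝ) (hcont : ContinuousOn g (Set.uIcc (-r) r)) :
    ∫ v in (-r)..r, Complex.exp (Complex.I * (v : ℂ) * c) * (g v : ℂ)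
      = ((2 * ∫ v in (0 : ℝ)..r, Real.cos (v * c) * g v : ℝ) : ℂ) := by
  set f : ℝ → ℂ := fun v => Complex.exp (Complex.I * (v : ℂ) * c) * (g v : ℂ)
  have hf : ContinuousOn f (Set.uIcc (-r) r) :=
    ContinuousOn.mul (by fun_prop) (Complex.continuous_ofReal.comp_continuousOn hcont)
  have h0 : (0 : ℝ) ∈ Set.uIcc (-r) r := by
    rw [Set.mem_uIcc]
    rcases le_total 0 r with h | h
    · exact Or.inl ⟨by linarith, h⟩
    · exact Or.inr ⟨h, by linarith⟩
  have h1 : ContinuousOn f (Set.uIcc (-r) 0) :=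
    hf.mono (Set.uIcc_subset_uIcc Set.left_mem_uIcc h0)
  have h2 : ContinuousOn f (Set.uIcc 0 r) :=
    hf.mono (Set.uIcc_subset_uIcc h0 Set.right_mem_uIcc)
  have h3 : ContinuousOn (fun v => f (-v)) (Set.uIcc 0 r) := by
    refine hf.comp (by fun_prop) fun v hv => ?_
    have := Set.uIcc_subset_uIcc h0 Set.right_mem_uIcc hv
    rw [Set.mem_uIcc] at this ⊢
    rcases this with h | h
    · exact Or.inl ⟨by linarith, by linarith⟩
    · exact Or.inr ⟨by linarith, by linarith⟩
  have hneg : ∫ v in (-r)..0, f v = ∫ v in (0 : ℝ)..r, f (-v) := by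
    rw [intervalIntegral.integral_comp_neg, neg_zero]
  rw [← intervalIntegral.integral_add_adjacent_intervals h1.intervalIntegrable
    h2.intervalIntegrable, hneg,
    ← intervalIntegral.integral_add h3.intervalIntegrable h2.intervalIntegrable,
    ← intervalIntegral.integral_const_mul, ← intervalIntegral.integral_ofReal]
  refine intervalIntegral.integral_congr fun v _ => ?_
  simp only [f, hg]
  push_cast
  rw [Complex.cos]
  ring_nf

theorem integral_limit_eq {a : ℕ} (ha : 2 ≤ a) (s t : ℕ) (x y : ℤ) :
    (1 / (2 * (Real.pi : ℂ))) * ∫ l in (-Real.pi)..Real.pi,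
      Complex.exp (Complex.I * ((l / (2 * (a : ℝ)) : ℝ) : ℂ) * ((y : ℂ) - x))
        * ((1 / (a : ℂ))
          * ((Real.cos (l / (2 * (a : ℝ))) ^ ((s : ℤ) - (t : ℤ)) : ℝ) : ℂ))
    = ((2 * ∫ v in (0 : ℝ)..(1 / (2 * (a : ℝ))),
          Real.cos (Real.pi * v * ((y - x : ℤ) : ℝ))
            * (Real.cos (Real.pi * v)) ^ ((s : ℤ) - (t : ℤ)) : ℝ) : ℂ) := by
  have ha0 : (a : ℝ) ≠ 0 := by exact_mod_cast (by omega : a ≠ 0)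
  have hac : (a : ℂ) ≠ 0 := by exact_mod_cast ha0
  have hπ := Real.pi_ne_zero
  have hπc : (Real.pi : ℂ) ≠ 0 := by exact_mod_cast hπ
  have key := integral_exp_mul_eq_two_mul_integral_cos
    (fun l => Real.cos (l / (2 * (a : ℝ))) ^ ((s : ℤ) - (t : ℤ)))
    (fun v => by simp only [neg_div, Real.cos_neg]) Real.pi ((y - x) / (2 * a)) (by
      refine ContinuousOn.zpow₀ (by fun_prop) _ fun l hl => Or.inl ?_
      rw [Set.uIcc_of_le (by linarith [Real.pi_pos])] at hl
      exact (cos_div_two_mul_pos ha (abs_le.mpr hl)).ne')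
  have hsub := intervalIntegral.integral_comp_mul_left
    (fun l => Real.cos (l * ((y - x) / (2 * a)))
      * Real.cos (l / (2 * (a : ℝ))) ^ ((s : ℤ) - (t : ℤ)))
    (c := 2 * a * Real.pi) (by positivity) (a := 0) (b := 1 / (2 * (a : ℝ)))
  rw [mul_zero, show 2 * a * Real.pi * (1 / (2 * (a : ℝ))) = Real.pi by field_simp,
    smul_eq_mul] at hsub
  have e1 : ∀ v : ℝ, 2 * a * Real.pi * v * ((y - x) / (2 * a))
      = Real.pi * v * ((y - x : ℤ) : ℝ) := fun v => by push_cast; field_simp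
  have e2 : ∀ v : ℝ, 2 * a * Real.pi * v / (2 * a) = Real.pi * v := fun v => by field_simp
  simp only [e1, e2] at hsub
  rw [hsub]
  have hL : ∀ l : ℝ, Complex.exp (Complex.I * ((l / (2 * (a : ℝ)) : ℝ) : ℂ) * ((y : ℂ) - x))
        * ((1 / (a : ℂ))
          * ((Real.cos (l / (2 * (a : ℝ))) ^ ((s : ℤ) - (t : ℤ)) : ℝ) : ℂ))
      = (1 / (a : ℂ)) * (Complex.exp (Complex.I * (l : ℂ) * (((y - x) / (2 * a) : ℝ) : ℂ))
          * ((Real.cos (l / (2 * (a : ℝ))) ^ ((s : ℤ) - (t : ℤ)) : ℝ) : ℂ)) := fun l => by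
    rw [mul_left_comm]
    congr 3
    push_cast
    ring
  simp only [hL]
  rw [intervalIntegral.integral_const_mul, key]
  generalize (∫ l in (0 : ℝ)..Real.pi, _ : ℝ) = J
  push_cast
  field_simp

theorem tendsto_integral_kernelIntegrand {a : ℕ} (ha : 2 ≤ a) (s t : ℕ) (x y : ℤ) :
    Tendsto (fun n : ℕ => ∫ l in (-Real.pi)..Real.pi,
      kernelIntegrand a (s + 2 * n) (t + 2 * n) x y l) atTop
      (𝓝 (∫ l in (-Real.pi)..Real.pi,
        Complex.exp (Complex.I * ((l / (2 * (a : ℝ)) : ℝ) : ℂ) * ((y : ℂ) - x))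
          * ((1 / (a : ℂ))
            * ((Real.cos (l / (2 * (a : ℝ))) ^ ((s : ℤ) - (t : ℤ)) : ℝ) : ℂ)))) := by
  have hlt : ∀ᵐ l : ℝ, l ∈ Set.uIoc (-Real.pi) Real.pi → |l| < Real.pi := by
    filter_upwards [Measure.ae_ne volume Real.pi] with l hne hl
    rw [Set.uIoc_of_le (by linarith [Real.pi_pos])] at hl
    exact abs_lt.mpr ⟨hl.1, lt_of_le_of_ne hl.2 hne⟩
  refine intervalIntegral.tendsto_integral_filter_of_dominated_convergence
    (fun l => 1 / Real.cos (l / (2 * (a : ℝ))) ^ t) ?_ ?_ ?_ ?_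
  · refine Eventually.of_forall fun n => ?_
    exact ((continuousOn_kernelIntegrand ha _ _ x y).mono Set.uIoc_subset_uIcc).aestronglyMeasurable
      measurableSet_uIoc
  · refine Eventually.of_forall fun n => ?_
    filter_upwards [hlt] with l hl hmem
    exact norm_kernelIntegrand_le ha s t n x y (hl hmem)
  · refine ContinuousOn.intervalIntegrable ?_
    refine continuousOn_const.div (by fun_prop) fun l hl => pow_ne_zero _ ?_
    rw [Set.uIcc_of_le (by linarith [Real.pi_pos])] at hl
    exact (cos_div_two_mul_pos ha (abs_le.mpr hl)).ne'
  · filter_upwards [hlt] with l hl hmem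
    exact tendsto_kernelIntegrand ha s t x y (hl hmem)

/-- **Relaxation of the correlation kernel to the discrete extended sine kernel.**
Let `a ∈ {2,3,…}`, `ρ = 1/(2a)`, and
`M^{2aj}_a(τ, y) = (1/2π) ∫_{−π}^{π} e^{iλ(y/2a − j)} [cos(λ/2a)]^{−τ} dλ`.
Fix `s, t, x, y` with `s+x`, `t+y` even.  Then the series
`Σ_{j∈ℤ} p(s+2n, x|2aj) M^{2aj}_a(t+2n, y)` converges absolutely for each `n` and tends,
as `n → ∞`, to `2∫_0^ρ cos(πu(y−x)) [cos(πu)]^{s−t} du`; consequently the kernel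
`K_n(s,x;t,y) = Σ_j p(s+2n,x|2aj) M^{2aj}_a(t+2n,y) − 1(s>t) p(s−t,x|y)` converges to the
equilibrium kernel `K_ρ(t−s, y−x)`, which for `s = t`, `y ≠ x` equals
`2 sin(πρ(y−x))/(π(y−x))`. -/
theorem relaxation_to_discrete_extended_sine_kernel
    (a : ℕ) (ha : 2 ≤ a) (ρ : ℝ) (hρ : ρ = 1 / (2 * (a : ℝ)))
    (Mf : ℤ → ℕ → ℤ → ℂ)
    (hMf : ∀ (j : ℤ) (τ : ℕ) (y : ℤ), Mf j τ y
      = (1 / (2 * (Real.pi : ℂ)))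
        * ∫ lam in (-Real.pi)..Real.pi,
            Complex.exp (Complex.I * (lam : ℂ)
                * (((y : ℝ) / (2 * (a : ℝ)) : ℝ) - (j : ℂ)))
              / ((Real.cos (lam / (2 * (a : ℝ))) : ℝ) : ℂ) ^ τ)
    (s t : ℕ) (x y : ℤ) (hsx : Even ((s : ℤ) + x)) (hty : Even ((t : ℤ) + y)) :
    (∀ n : ℕ, Summable (fun j : ℤ =>
        ‖((rwTP (s + 2 * n) x (2 * (a : ℤ) * j) : ℝ) : ℂ) * Mf j (t + 2 * n) y‖)) ∧
    Tendsto (fun n : ℕ =>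
        ∑' j : ℤ, ((rwTP (s + 2 * n) x (2 * (a : ℤ) * j) : ℝ) : ℂ) * Mf j (t + 2 * n) y)
      atTop (nhds (((2 * ∫ v in (0 : ℝ)..ρ,
          Real.cos (Real.pi * v * ((y - x : ℤ) : ℝ))
            * (Real.cos (Real.pi * v)) ^ ((s : ℤ) - (t : ℤ)) : ℝ)) : ℂ)) ∧
    Tendsto (fun n : ℕ =>
        (∑' j : ℤ, ((rwTP (s + 2 * n) x (2 * (a : ℤ) * j) : ℝ) : ℂ) * Mf j (t + 2 * n) y)
          - (if t < s then ((rwTP (s - t) x y : ℝ) : ℂ) else 0))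
      atTop (nhds ((((2 * ∫ v in (0 : ℝ)..ρ,
          Real.cos (Real.pi * v * ((y - x : ℤ) : ℝ))
            * (Real.cos (Real.pi * v)) ^ ((s : ℤ) - (t : ℤ)) : ℝ)) : ℂ)
          - (if t < s then ((rwTP (s - t) x y : ℝ) : ℂ) else 0))) ∧
    (s = t → y ≠ x →
      (2 * ∫ v in (0 : ℝ)..ρ,
          Real.cos (Real.pi * v * ((y - x : ℤ) : ℝ))
            * (Real.cos (Real.pi * v)) ^ ((s : ℤ) - (t : ℤ)) : ℝ)
        = 2 * Real.sin (Real.pi * ρ * ((y - x : ℤ) : ℝ)) / (Real.pi * ((y - x : ℤ) : ℝ))) := by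
  have ha0 : a ≠ 0 := by omega
  have hlim : Tendsto (fun n : ℕ =>
        ∑' j : ℤ, ((rwTP (s + 2 * n) x (2 * (a : ℤ) * j) : ℝ) : ℂ) * Mf j (t + 2 * n) y)
      atTop (nhds (((2 * ∫ v in (0 : ℝ)..ρ,
          Real.cos (Real.pi * v * ((y - x : ℤ) : ℝ))
            * (Real.cos (Real.pi * v)) ^ ((s : ℤ) - (t : ℤ)) : ℝ)) : ℂ)) := by
    rw [hρ, ← integral_limit_eq ha]
    refine ((tendsto_integral_kernelIntegrand ha s t x y).const_mul _).congr fun n => ?_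
    have hx : Even (((s + 2 * n : ℕ) : ℤ) + x) := by
      rw [show ((s + 2 * n : ℕ) : ℤ) + x = (s + x) + 2 * n by push_cast; ring]
      exact hsx.add (even_two_mul _)
    simp only [hMf]
    exact (tsum_rwTP_mul_integral ha _ _ x y hx).symm
  refine ⟨fun n => ?_, hlim, hlim.sub_const _, fun hst hxy => ?_⟩
  · refine summable_of_ne_finset_zero
      (s := Finset.Icc (-(((s + 2 * n : ℕ) : ℤ) + |x|)) ((s + 2 * n : ℕ) + |x|)) fun j hj => ?_
    rw [rwTP_eq_zero_of_notMem_Icc a ha0 _ x j hj]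
    simp
  · have hd : ((y - x : ℤ) : ℝ) ≠ 0 := by exact_mod_cast sub_ne_zero.mpr hxy
    set d := ((y - x : ℤ) : ℝ)
    have hc : Real.pi * d ≠ 0 := mul_ne_zero Real.pi_ne_zero hd
    simp only [hst, sub_self, zpow_zero, mul_one, mul_right_comm Real.pi _ d]
    rw [intervalIntegral.integral_comp_mul_left (fun u => Real.cos u) hc, integral_cos, mul_zero,
      Real.sin_zero, sub_zero, smul_eq_mul]
    field_simp
end

section
/- Gaussian integral formula for the martingale functions of the Dyson model with equidistant initial configuration. Let a ∈ ℕ with a ≥ 1, k ∈ ℤ, t > 0 and y ∈ ℝ. Then ∫_ℝ (2πt)^{−1/2} e^{−v²/(2t)} · sin(π((y + iv)/(2a) − k)) / (π((y + iv)/(2a) − k)) dv = (1/2π) ∫_{−π}^{π} e^{λ² t/(8a²) + iλ(y/(2a) − k)} dλ, where the left-hand integrand is integrable and sin w / w is understood to equal 1 at w = 0. -/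
open MeasureTheory

open ProbabilityTheory in
theorem integrable_gaussianReal_iff_integrable_smul {E : Type*} [NormedAddCommGroup E]
    [NormedSpace ℝ E] {m : ℝ} {v : NNReal} (hv : v ≠ 0) {f : ℝ → E} :
    Integrable f (gaussianReal m v) ↔ Integrable (fun x => gaussianPDFReal m v x • f x) := by
  rw [gaussianReal_of_var_ne_zero m hv, integrable_withDensity_iff_integrable_smul'
    (measurable_gaussianPDF m v) (ae_of_all _ fun _ => gaussianPDF_lt_top)]
  simp only [toReal_gaussianPDF]

/-- The normalized sinc function as the Fourier transform of the uniform density on `(-π, π)`. -/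
theorem integral_exp_I_mul_mul_eq_sin_div (w : ℂ) :
    (1 / (2 * (Real.pi : ℂ))) * ∫ l in (-Real.pi)..Real.pi, Complex.exp (Complex.I * l * w)
      = if w = 0 then 1 else Complex.sin (Real.pi * w) / (Real.pi * w) := by
  have hpi : (Real.pi : ℂ) ≠ 0 := Complex.ofReal_ne_zero.mpr Real.pi_ne_zero
  split_ifs with hw
  · subst hw
    simp only [mul_zero, Complex.exp_zero, intervalIntegral.integral_const, Complex.real_smul]
    push_cast
    field_simp
    norm_num
  · have h (l : ℝ) : Complex.I * l * w = Complex.I * w * l := by ring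
    simp_rw [h]
    rw [integral_exp_mul_complex (mul_ne_zero Complex.I_ne_zero hw), Complex.sin]
    have h₁ : Complex.I * w * (Real.pi : ℝ) = Real.pi * w * Complex.I := by ring
    have h₂ : Complex.I * w * ((-Real.pi : ℝ) : ℂ) = -(Real.pi * w) * Complex.I := by
      push_cast; ring
    rw [h₁, h₂]
    have hI := Complex.I_ne_zero
    field_simp
    rw [Complex.I_sq]
    ring

open ProbabilityTheory in
theorem integrable_prod_gaussianReal_exp (v : NNReal) (α β r : ℝ) :
    Integrable (fun p : ℝ × ℝ =>
        Complex.exp (Complex.I * p.2 * ((α : ℂ) + β * p.1 * Complex.I)))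
      ((gaussianReal 0 v).prod (volume.restrict (Set.Ioc (-r) r))) := by
  have hb : Integrable (fun p : ℝ × ℝ =>
      (Real.exp ((r * β) * p.1) + Real.exp ((-(r * β)) * p.1)) * (1 : ℝ))
      ((gaussianReal 0 v).prod (volume.restrict (Set.Ioc (-r) r))) :=
    ((integrable_exp_mul_gaussianReal (r * β)).add
      (integrable_exp_mul_gaussianReal (-(r * β)))).mul_prod (integrable_const 1)
  refine hb.mono' (by fun_prop) ?_
  have hm : ∀ᵐ p ∂((gaussianReal 0 v).prod (volume.restrict (Set.Ioc (-r) r))),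
      p.2 ∈ Set.Ioc (-r) r :=
    Measure.quasiMeasurePreserving_snd.ae (ae_restrict_mem measurableSet_Ioc)
  filter_upwards [hm] with p hp
  have hre : (Complex.I * p.2 * ((α : ℂ) + β * p.1 * Complex.I)).re = -(p.2 * (β * p.1)) := by
    simp [Complex.mul_re, Complex.mul_im]
  rw [Complex.norm_exp, hre, mul_one]
  rcases le_total 0 (β * p.1) with h | h
  · have : -(p.2 * (β * p.1)) ≤ r * β * p.1 := by nlinarith [hp.1]
    linarith [Real.exp_le_exp.mpr this, Real.exp_pos (-(r * β) * p.1)]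
  · have : -(p.2 * (β * p.1)) ≤ -(r * β) * p.1 := by nlinarith [hp.2]
    linarith [Real.exp_le_exp.mpr this, Real.exp_pos (r * β * p.1)]

open ProbabilityTheory in
theorem integral_gaussianReal_exp_I_mul (v : NNReal) (α β l : ℝ) :
    ∫ x, Complex.exp (Complex.I * l * ((α : ℂ) + β * x * Complex.I)) ∂(gaussianReal 0 v)
      = Complex.exp (((l ^ 2 * β ^ 2 * v / 2 : ℝ) : ℂ) + Complex.I * l * α) := by
  have h (x : ℝ) : Complex.exp (Complex.I * l * ((α : ℂ) + β * x * Complex.I))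
      = Complex.exp (Complex.I * l * α) * Complex.exp ((-(l * β) : ℂ) * x) := by
    rw [← Complex.exp_add]
    congr 1
    linear_combination (l * β * x : ℂ) * Complex.I_sq
  have hm := complexMGF_id_gaussianReal (μ := 0) (v := v) (-(l * β) : ℂ)
  simp only [complexMGF, id] at hm
  simp_rw [h]
  rw [integral_const_mul, hm, ← Complex.exp_add]
  congr 1
  push_cast
  ring

/-- **Gaussian integral formula for the martingale functions of the Dyson model with
equidistant initial configuration.**  For `a ≥ 1`, `k ∈ ℤ`, `t > 0` and `y ∈ ℝ`, with
`Φ(z) = sin(π(z/2a − k))/(π(z/2a − k))` (equal to `1` at `z = 2ak`),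
`∫_ℝ (2πt)^{−1/2} e^{−v²/(2t)} Φ(y + iv) dv
  = (1/2π) ∫_{−π}^{π} e^{λ²t/(8a²) + iλ(y/2a − k)} dλ`,
the left-hand integrand being integrable. -/
theorem gaussian_integral_formula_dyson_equidistant
    (a : ℕ) (ha : 1 ≤ a) (k : ℤ) (t : ℝ) (ht : 0 < t) (y : ℝ)
    (Φ : ℂ → ℂ)
    (hΦ : ∀ z : ℂ, Φ z = if z = 2 * (a : ℂ) * (k : ℂ) then 1
      else Complex.sin ((Real.pi : ℂ) * (z / (2 * (a : ℂ)) - (k : ℂ)))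
        / ((Real.pi : ℂ) * (z / (2 * (a : ℂ)) - (k : ℂ)))) :
    Integrable (fun v : ℝ =>
      (((2 * Real.pi * t) ^ (-(1 / 2 : ℝ)) * Real.exp (-v ^ 2 / (2 * t)) : ℝ) : ℂ)
        * Φ ((y : ℂ) + (v : ℂ) * Complex.I)) volume ∧
    (∫ v : ℝ,
        (((2 * Real.pi * t) ^ (-(1 / 2 : ℝ)) * Real.exp (-v ^ 2 / (2 * t)) : ℝ) : ℂ)
          * Φ ((y : ℂ) + (v : ℂ) * Complex.I))
      = (1 / (2 * (Real.pi : ℂ)))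
        * ∫ lam in (-Real.pi)..Real.pi,
            Complex.exp (((lam ^ 2 * t / (8 * (a : ℝ) ^ 2) : ℝ) : ℂ)
              + Complex.I * (lam : ℂ) * (((y / (2 * (a : ℝ)) : ℝ) : ℂ) - (k : ℂ))) := by
  have ha0 : (a : ℂ) ≠ 0 := Nat.cast_ne_zero.mpr (by omega)
  obtain ⟨s, hs⟩ : ∃ s : NNReal, (s : ℝ) = t := ⟨t.toNNReal, Real.coe_toNNReal t ht.le⟩
  have hs0 : s ≠ 0 := by
    rintro rfl
    exact ht.ne hs
  set α : ℝ := y / (2 * a) - k with hα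
  set β : ℝ := 1 / (2 * a) with hβ
  have hg (v : ℝ) : (2 * Real.pi * t) ^ (-(1 / 2 : ℝ)) * Real.exp (-v ^ 2 / (2 * t))
      = ProbabilityTheory.gaussianPDFReal 0 s v := by
    rw [ProbabilityTheory.gaussianPDFReal, Real.rpow_neg (by positivity), ← Real.sqrt_eq_rpow,
      sub_zero, hs]
  have hΦ' (v : ℝ) : Φ (y + v * Complex.I) = (1 / (2 * (Real.pi : ℂ))) *
      ∫ l in (-Real.pi)..Real.pi, Complex.exp (Complex.I * l * ((α : ℂ) + β * v * Complex.I)) := by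
    have hw : ((y : ℂ) + v * Complex.I) / (2 * (a : ℂ)) - k = (α : ℂ) + β * v * Complex.I := by
      rw [hα, hβ]
      push_cast
      ring
    have hz : (y : ℂ) + v * Complex.I = 2 * (a : ℂ) * (k : ℂ) ↔
        (α : ℂ) + β * v * Complex.I = 0 := by
      rw [← hw, sub_eq_zero, div_eq_iff (by simpa using ha0), mul_comm (k : ℂ)]
    rw [hΦ, integral_exp_I_mul_mul_eq_sin_div, hw]
    simp only [hz]
  have hle : -Real.pi ≤ Real.pi := by linarith [Real.pi_pos]
  have hint := integrable_prod_gaussianReal_exp s α β Real.pi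
  have hsmul (v : ℝ) (z : ℂ) : (ProbabilityTheory.gaussianPDFReal 0 s v : ℂ) * z
      = ProbabilityTheory.gaussianPDFReal 0 s v • z := (Complex.real_smul ..).symm
  simp_rw [hg, hΦ', intervalIntegral.integral_of_le hle, hsmul]
  refine ⟨(integrable_gaussianReal_iff_integrable_smul hs0).mp
    (hint.integral_prod_left.const_mul _), ?_⟩
  rw [← ProbabilityTheory.integral_gaussianReal_eq_integral_smul hs0, integral_const_mul,
    integral_integral_swap hint]
  simp_rw [integral_gaussianReal_exp_I_mul]
  congr 2 with l
  congr 2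
  · rw [hβ, hs]
    congr 1
    ring
  · rw [hα]
    push_cast
    ring
end
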